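/- arXiv:0911.1475 — 2 statements merged into one kernel-verified Lean document; each statement's English description precedes it below -/
import Mathlib

section
/- Let p be a prime, q = p², and let N be a positive divisor of p−1. Let n : F_q → ℕ and suppose that the polynomial A = ∏_{γ ∈ F_q} (x−γ)^{N·p^{n(γ)} − 1} ∈ F_q[x] is perfect. Then n(γ + c) = n(γ) for every γ ∈ F_q and every c in the prime subfield F_p of F_q, and for every γ ∈ F_q the block ∏_{c ∈ F_p} (x−γ−c)^{N·p^{n(γ)} − 1} is itself perfect (so A is trivially perfect). -/
open Polynomial

/-- The sum of all monic divisors of a polynomial. -/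
noncomputable def polySigma {F : Type*} [Field F] (A : F[X]) : F[X] :=
  ∑ᶠ d ∈ {d : F[X] | d.Monic ∧ d ∣ A}, d

/-- A polynomial is perfect if it equals the sum of its monic divisors. -/
def IsPerfectPoly {F : Type*} [Field F] (A : F[X]) : Prop := polySigma A = A

/-- The exponents in a product of powers of distinct monic linear factors are determined by the
product. -/
theorem prod_X_sub_C_pow_inj {F ι : Type*} [Field F] [Fintype ι] {a : ι → F}
    (ha : Function.Injective a) {k l : ι → ℕ} :
    ∏ i, (X - C (a i)) ^ k i = ∏ i, (X - C (a i)) ^ l i ↔ k = l := by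
  classical
  refine ⟨fun h => ?_, fun h => by rw [h]⟩
  have key (m : ι → ℕ) (j : ι) : (∏ i, (X - C (a i)) ^ m i).roots.count (a j) = m j := by
    rw [roots_prod _ _ (Finset.prod_ne_zero_iff.2 fun i _ => pow_ne_zero _ (X_sub_C_ne_zero _)),
      Multiset.count_bind]
    simp only [roots_pow, roots_X_sub_C, Multiset.count_nsmul, Multiset.count_singleton,
      ha.eq_iff]
    simp
  funext j
  rw [← key k j, h, key l j]

/-- The sum of the monic divisors of a product of powers of distinct monic linear factors. -/
theorem polySigma_prod_X_sub_C_pow {F ι : Type*} [Field F] [Fintype ι] {a : ι → F}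
    (ha : Function.Injective a) (e : ι → ℕ) :
    polySigma (∏ i, (X - C (a i)) ^ e i) =
      ∏ i, ∑ k ∈ Finset.range (e i + 1), (X - C (a i)) ^ k := by
  classical
  have hset : {d : F[X] | d.Monic ∧ d ∣ ∏ i, (X - C (a i)) ^ e i} =
      ((Fintype.piFinset fun i => Finset.range (e i + 1)).image
        fun k => ∏ i, (X - C (a i)) ^ k i : Finset F[X]) := by
    ext d
    simp only [Set.mem_ofPred_eq, Finset.coe_image, Set.mem_image, Finset.mem_coe,
      Fintype.mem_piFinset, Finset.mem_range, Nat.lt_succ_iff]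
    constructor
    · rintro ⟨hd, hdvd⟩
      have hP : ∏ i, (X - C (a i)) ^ e i ≠ 0 :=
        Finset.prod_ne_zero_iff.2 fun i _ => pow_ne_zero _ (X_sub_C_ne_zero _)
      have hroots : (∏ i, (X - C (a i)) ^ e i).roots =
          Finset.univ.val.bind fun i => e i • ({a i} : Multiset F) := by
        rw [roots_prod _ _ hP]
        simp only [roots_pow, roots_X_sub_C]
      have hle := roots.le_of_dvd hP hdvd
      have hsplit : d.Splits :=
        Splits.of_dvd (Splits.prod fun i _ => (Splits.X_sub_C (a i)).pow _) hP hdvd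
      refine ⟨fun i => d.roots.count (a i), fun i => ?_, ?_⟩
      · refine (Multiset.count_le_of_le (a i) hle).trans ?_
        rw [hroots, Multiset.count_bind]
        simp [Multiset.count_nsmul, Multiset.count_singleton, ha.eq_iff]
      · conv_rhs => rw [hsplit.eq_prod_roots_of_monic hd, Finset.prod_multiset_map_count]
        rw [← Finset.prod_image (s := Finset.univ) (g := a)
          (f := fun b => (X - C b) ^ d.roots.count b) ha.injOn]
        symm
        refine Finset.prod_subset (fun b hb => ?_) fun b _ hb => ?_
        · have := Multiset.mem_of_le hle (Multiset.mem_toFinset.1 hb)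
          rw [hroots, Multiset.mem_bind] at this
          obtain ⟨i, -, hi⟩ := this
          have := Multiset.mem_of_mem_nsmul hi
          rw [Multiset.mem_singleton] at this
          exact Finset.mem_image.2 ⟨i, Finset.mem_univ _, this.symm⟩
        · rw [Multiset.mem_toFinset] at hb
          rw [Multiset.count_eq_zero_of_notMem hb, pow_zero]
    · rintro ⟨k, hk, rfl⟩
      exact ⟨monic_prod_of_monic _ _ fun i _ => (monic_X_sub_C _).pow _,
        Finset.prod_dvd_prod_of_dvd _ _ fun i _ => pow_dvd_pow _ (hk i)⟩
  rw [polySigma, hset, finsum_mem_coe_finset,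
    Finset.sum_image fun k _ l _ h => (prod_X_sub_C_pow_inj ha).1 h, Finset.prod_univ_sum]

/-- If `N` divides `p - 1`, there is a primitive `N`-th root of unity modulo `p`. -/
theorem ZMod.exists_isPrimitiveRoot_of_dvd (p : ℕ) [Fact p.Prime] {N : ℕ} (hN : N ∣ p - 1) :
    ∃ ζ : ZMod p, IsPrimitiveRoot ζ N := by
  obtain ⟨g, hg⟩ := IsCyclic.exists_generator (α := (ZMod p)ˣ)
  have hord : orderOf g = p - 1 := by
    rw [orderOf_eq_card_of_forall_mem_zpowers hg, Nat.card_eq_fintype_card, ZMod.card_units]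
  obtain ⟨b, hb⟩ := hN
  have hp1 : 0 < p - 1 := Nat.sub_pos_of_lt (Fact.out : p.Prime).one_lt
  have h := (IsPrimitiveRoot.orderOf g).pow (a := b) (b := N) (by omega)
    (by rw [hord, hb, mul_comm])
  exact ⟨_, IsPrimitiveRoot.coe_units_iff.2 h⟩

/-- Perfectness of a product of powers `N * p ^ n i - 1` of linear factors whose roots are
permuted by translation by the prime field, in terms of the exponents: the function `p ^ n` is
its own average over translates by `N`-th roots of unity. -/
theorem isPerfectPoly_prod_iff {p : ℕ} [Fact p.Prime] {F : Type*} [Field F] [CharP F p]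
    {N : ℕ} (hN : 0 < N) {ζ : ZMod p} (hζ : IsPrimitiveRoot ζ N)
    {ι : Type*} [Fintype ι] [AddCommGroup ι] (ψ : ZMod p → ι) {a : ι → F}
    (ha : Function.Injective a)
    (hψ : ∀ i c, a (i + ψ c) = a i + ZMod.castHom (dvd_refl p) F c) (n : ι → ℕ) :
    IsPerfectPoly (∏ i, (X - C (a i)) ^ (N * p ^ n i - 1)) ↔
      ∀ i, N * p ^ n i = ∑ u ∈ nthRootsFinset N (1 : ZMod p), p ^ n (i - ψ u) := by
  set φ := ZMod.castHom (dvd_refl p) F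
  have hpos (i : ι) : N * p ^ n i - 1 + 1 = N * p ^ n i :=
    Nat.sub_add_cancel (Nat.mul_pos hN (pow_pos (Fact.out : p.Prime).pos _))
  have hroots : (X ^ N - 1 : F[X]) = ∏ u ∈ nthRootsFinset N (1 : ZMod p), (X - C (φ u)) := by
    have := congrArg (Polynomial.map φ) (X_pow_sub_one_eq_prod hN hζ)
    simpa [Polynomial.map_prod] using this
  have hfac (i : ι) : (X - C (a i)) ^ (N * p ^ n i) - 1 =
      ∏ u ∈ nthRootsFinset N (1 : ZMod p), (X - C (a (i + ψ u))) ^ p ^ n i := by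
    have h := congrArg (fun f : F[X] => f.comp (X - C (a i))) hroots
    simp only [sub_comp, pow_comp, X_comp, one_comp, prod_comp, C_comp] at h
    rw [pow_mul, ← one_pow (p ^ n i), ← sub_pow_char_pow, h, ← Finset.prod_pow]
    simp only [hψ, C_add, sub_sub]
  have hshift : ∏ i, (X - C (a i) - 1) = ∏ i, (X - C (a i)) := by
    refine Fintype.prod_equiv (Equiv.addRight (ψ 1)) _ _ fun i => ?_
    rw [Equiv.coe_addRight, hψ, map_one, C_add, C_1, sub_sub]
  have hne : ∏ i, (X - C (a i)) ≠ 0 := Finset.prod_ne_zero_iff.2 fun i _ => X_sub_C_ne_zero _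
  have hleft : (∏ i, (X - C (a i))) * polySigma (∏ i, (X - C (a i)) ^ (N * p ^ n i - 1)) =
      ∏ i, (X - C (a i)) ^ ∑ u ∈ nthRootsFinset N (1 : ZMod p), p ^ n (i - ψ u) := by
    rw [polySigma_prod_X_sub_C_pow ha, ← hshift, ← Finset.prod_mul_distrib]
    simp only [hpos, mul_geom_sum, hfac, ← Finset.prod_pow_eq_pow_sum]
    rw [Finset.prod_comm]
    conv_rhs => rw [Finset.prod_comm]
    refine Finset.prod_congr rfl fun u _ => ?_
    refine (Fintype.prod_equiv (Equiv.addRight (ψ u)) _ _ fun i => ?_)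
    simp
  have hright : (∏ i, (X - C (a i))) * ∏ i, (X - C (a i)) ^ (N * p ^ n i - 1) =
      ∏ i, (X - C (a i)) ^ (N * p ^ n i) := by
    rw [← Finset.prod_mul_distrib]
    simp only [← pow_succ', hpos]
  rw [IsPerfectPoly, ← mul_right_inj' hne, hleft, hright, prod_X_sub_C_pow_inj ha, funext_iff]
  exact forall_congr' fun i => eq_comm

/-- A function on `ZMod p` that equals its average over translates by a finite set containing
`1` is constant. -/
theorem ZMod.eq_of_card_mul_eq_sum {p : ℕ} [NeZero p] {U : Finset (ZMod p)} (hU : 1 ∈ U)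
    {g : ZMod p → ℕ} (hg : ∀ c, U.card * g c = ∑ u ∈ U, g (c - u)) (c d : ZMod p) :
    g c = g d := by
  obtain ⟨m, hm⟩ := Finite.exists_max g
  have key (k : ℕ) : g (m - k) = g m := by
    induction k with
    | zero => simp
    | succ k ih =>
      have h := hg (m - k)
      rw [ih, ← smul_eq_mul, ← Finset.sum_const] at h
      have := (Finset.sum_eq_sum_iff_of_le fun u _ => hm (m - k - u)).1 h.symm 1 hU
      rw [← this, Nat.cast_succ, sub_sub]
  have all (c : ZMod p) : g c = g m := by
    simpa using key (m - c).val
  rw [all c, all d]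

theorem stmt1 (p : ℕ) (hp : p.Prime) [NeZero p] (F : Type*) [Field F] [Fintype F]
    [CharP F p] (hcard : Fintype.card F = p ^ 2)
    (N : ℕ) (hN1 : 0 < N) (hNp : N ∣ p - 1)
    (n : F → ℕ)
    (hperf : IsPerfectPoly (∏ γ : F, (X - C γ) ^ (N * p ^ n γ - 1))) :
    (∀ (γ : F) (c : ZMod p), n (γ + ZMod.castHom (dvd_refl p) F c) = n γ) ∧
      ∀ γ : F, IsPerfectPoly
        (∏ c : ZMod p,
          (X - C γ - C (ZMod.castHom (dvd_refl p) F c)) ^ (N * p ^ n γ - 1)) := by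
  have : Fact p.Prime := ⟨hp⟩
  obtain ⟨ζ, hζ⟩ := ZMod.exists_isPrimitiveRoot_of_dvd p hNp
  refine ⟨fun γ c => ?_, fun γ => ?_⟩
  · have havg := (isPerfectPoly_prod_iff hN1 hζ (ZMod.castHom (dvd_refl p) F) (a := id)
      Function.injective_id (fun _ _ => rfl) n).1 hperf
    have h := ZMod.eq_of_card_mul_eq_sum (U := nthRootsFinset N (1 : ZMod p))
      ((mem_nthRootsFinset hN1 1).2 (one_pow N))
      (g := fun c => p ^ n (γ + ZMod.castHom (dvd_refl p) F c))
      (fun c => by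
        rw [hζ.card_nthRootsFinset, havg]
        simp only [map_sub, add_sub_assoc]) c 0
    simpa using Nat.pow_right_injective hp.two_le h
  · simp only [sub_sub, ← C_add]
    refine (isPerfectPoly_prod_iff hN1 hζ id
      (a := fun c => γ + ZMod.castHom (dvd_refl p) F c)
      ((add_right_injective γ).comp (ZMod.castHom (dvd_refl p) F).injective)
      (fun i c => by simp only [id, map_add, add_assoc]) fun _ => n γ).2 fun c => ?_
    rw [Finset.sum_const, hζ.card_nthRootsFinset, smul_eq_mul]
end

section
/- Let p be a prime, q = p², and let N be a divisor of q−1 that does not divide p−1. Define λ_0, …, λ_{p−1} ∈ ℚ by λ_j = ∑_{i=0}^{p−1} a_{j,i}. Then the p×p circulant matrix over ℚ with entries (m,n) ↦ λ_{n−m} (indices taken in ℤ/pℤ) has rank p−1. -/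
/-- Maximum principle for circulant matrices: if the entries sum to zero, are nonnegative off the
diagonal and not all zero there, then the kernel consists of constant vectors. -/
lemma circulant_mulVec_eq_zero_const {p : ℕ} [Fact p.Prime] (c : ZMod p → ℚ)
    (hsum : ∑ j, c j = 0) (hnonneg : ∀ j, j ≠ 0 → 0 ≤ c j)
    {j₀ : ZMod p} (hj₀ : j₀ ≠ 0) (hpos : 0 < c j₀) (v : ZMod p → ℚ)
    (hv : (Matrix.of fun m n : ZMod p => c (n - m)).mulVec v = 0) :
    ∃ t : ℚ, ∀ m, v m = t := by
  obtain ⟨m₀, hm₀⟩ := Finite.exists_max v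
  have hrow : ∀ m, ∑ j, c j * (v m - v (m + j)) = 0 := by
    intro m
    have h := congrFun hv m
    simp only [Matrix.mulVec, dotProduct, Matrix.of_apply, Pi.zero_apply] at h
    rw [← Equiv.sum_comp (Equiv.addLeft m)] at h
    simp only [Equiv.coe_addLeft, add_sub_cancel_left] at h
    simp only [mul_sub, Finset.sum_sub_distrib, ← Finset.sum_mul, hsum, h]
    ring
  have hstep : ∀ m, v m = v m₀ → v (m + j₀) = v m₀ := by
    intro m hm
    have h := (Finset.sum_eq_zero_iff_of_nonneg (fun j _ => ?_)).1 (hrow m) j₀ (Finset.mem_univ _)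
    · rcases mul_eq_zero.1 h with h | h
      · exact absurd h hpos.ne'
      · linarith
    · by_cases hj : j = 0
      · simp [hj]
      · exact mul_nonneg (hnonneg j hj) (by rw [hm]; exact sub_nonneg.2 (hm₀ _))
  have hiter : ∀ k : ℕ, v (m₀ + k * j₀) = v m₀ := by
    intro k
    induction k with
    | zero => simp
    | succ k ih =>
      have h := hstep _ ih
      rwa [add_assoc, ← add_one_mul, ← Nat.cast_succ] at h
  refine ⟨v m₀, fun m => ?_⟩
  have h := hiter ((m - m₀) / j₀).val
  rwa [ZMod.natCast_zmod_val, div_mul_cancel₀ _ hj₀, add_sub_cancel] at h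

/-- A circulant matrix of prime size whose entries sum to zero, are nonnegative off the diagonal
and not all zero there, has corank one. -/
lemma rank_circulant_eq_pred {p : ℕ} [Fact p.Prime] (c : ZMod p → ℚ)
    (hsum : ∑ j, c j = 0) (hnonneg : ∀ j, j ≠ 0 → 0 ≤ c j)
    {j₀ : ZMod p} (hj₀ : j₀ ≠ 0) (hpos : 0 < c j₀) :
    (Matrix.of fun m n : ZMod p => c (n - m)).rank = p - 1 := by
  set M := Matrix.of fun m n : ZMod p => c (n - m) with hM
  have hker : LinearMap.ker M.mulVecLin = Submodule.span ℚ {fun _ => (1 : ℚ)} := by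
    ext v
    rw [LinearMap.mem_ker, Matrix.mulVecLin_apply, Submodule.mem_span_singleton]
    constructor
    · intro hv
      obtain ⟨t, ht⟩ := circulant_mulVec_eq_zero_const c hsum hnonneg hj₀ hpos v hv
      exact ⟨t, funext fun m => by simp [ht m]⟩
    · rintro ⟨t, rfl⟩
      ext m
      simp only [hM, Matrix.mulVec, dotProduct, Matrix.of_apply, Pi.zero_apply, Pi.smul_apply,
        smul_eq_mul, mul_one, ← Finset.sum_mul]
      rw [← Equiv.sum_comp (Equiv.addLeft m)]
      simp [hsum]
  have h := LinearMap.finrank_range_add_finrank_ker M.mulVecLin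
  have hone : (fun _ => (1 : ℚ) : ZMod p → ℚ) ≠ 0 := fun h => one_ne_zero (congrFun h 0)
  rw [hker, finrank_span_singleton hone, Module.finrank_fintype_fun_eq_card, ZMod.card] at h
  rw [Matrix.rank]
  omega

/-- In a field with `p ^ 2` elements, `1` and an element outside the prime field give affine
coordinates. -/
lemma bijective_one_sub_mul_sub {p : ℕ} [Fact p.Prime] {F : Type*} [Field F] [Fintype F]
    [CharP F p] (hcard : Fintype.card F = p ^ 2) {α : F}
    (hα : α ∉ Set.range (ZMod.castHom (dvd_refl p) F)) :
    Function.Bijective fun x : ZMod p × ZMod p =>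
      (1 : F) - ZMod.castHom (dvd_refl p) F x.1 * α - ZMod.castHom (dvd_refl p) F x.2 := by
  set φ := ZMod.castHom (dvd_refl p) F
  rw [Fintype.bijective_iff_injective_and_card]
  refine ⟨?_, by simp [hcard, ZMod.card, sq]⟩
  rintro ⟨j, i⟩ ⟨j', i'⟩ h
  have h' : φ (j - j') * α = φ (i' - i) := by
    rw [map_sub, map_sub]
    linear_combination -h
  have hj : j - j' = 0 := by
    by_contra hne
    refine hα ⟨(i' - i) / (j - j'), ?_⟩
    rw [map_div₀, div_eq_iff ((map_ne_zero φ).2 hne), ← h', mul_comm]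
  rw [hj, map_zero, zero_mul] at h'
  have hi : i' - i = 0 := (map_eq_zero φ).1 h'.symm
  rw [Prod.mk.injEq]
  exact ⟨sub_eq_zero.1 hj, (sub_eq_zero.1 hi).symm⟩

lemma FiniteField.exists_isPrimitiveRoot_of_dvd {F : Type*} [Field F] [Fintype F] {N : ℕ}
    (hN : N ∣ Fintype.card F - 1) : ∃ ζ : F, IsPrimitiveRoot ζ N := by
  classical
  obtain ⟨g, hg⟩ := IsCyclic.exists_generator (α := Fˣ)
  have hord : orderOf g = Fintype.card F - 1 := by
    rw [orderOf_eq_card_of_forall_mem_zpowers hg, Nat.card_eq_fintype_card, Fintype.card_units]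
  obtain ⟨k, hk⟩ := hN
  have hpos : 0 < orderOf g := orderOf_pos g
  have h := (IsPrimitiveRoot.orderOf g).pow hpos (by rw [hord, hk, mul_comm] : orderOf g = k * N)
  exact ⟨_, IsPrimitiveRoot.coe_units_iff.2 h⟩

theorem stmt9 (p : ℕ) (hp : p.Prime) [NeZero p] (F : Type*) [Field F] [Fintype F]
    [DecidableEq F] [CharP F p] (hcard : Fintype.card F = p ^ 2)
    (α : F) (hα : α ∉ Set.range (ZMod.castHom (dvd_refl p) F))
    (N : ℕ) (hNq : N ∣ p ^ 2 - 1) (hNp : ¬ N ∣ p - 1)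
    (a : ZMod p → ZMod p → ℚ)
    (ha : ∀ j i : ZMod p,
      a j i = if j = 0 ∧ i = 1 then -(N : ℚ)
        else if ((1 : F) - ZMod.castHom (dvd_refl p) F j * α
            - ZMod.castHom (dvd_refl p) F i) ^ N = 1 then 1 else 0)
    (lam : ZMod p → ℚ) (hlam : ∀ j : ZMod p, lam j = ∑ i : ZMod p, a j i) :
    (Matrix.of fun m n : ZMod p => lam (n - m)).rank = p - 1 := by
  have : Fact p.Prime := ⟨hp⟩
  have hbij := bijective_one_sub_mul_sub hcard hα
  set φ := ZMod.castHom (dvd_refl p) F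
  obtain ⟨ζ, hζ⟩ := FiniteField.exists_isPrimitiveRoot_of_dvd (F := F) (hcard ▸ hNq)
  have hN : N ≠ 0 := by
    rintro rfl
    have h1 : 1 < p ^ 2 := Nat.one_lt_pow two_ne_zero hp.one_lt
    have h2 := Nat.eq_zero_of_zero_dvd hNq
    omega
  have hnonneg : ∀ j, j ≠ 0 → ∀ i, 0 ≤ a j i := by
    intro j hj i
    rw [ha, if_neg (fun h => hj h.1)]
    split_ifs <;> norm_num
  have ha' : ∀ j i, a j i = (if (1 - φ j * α - φ i) ^ N = 1 then 1 else 0)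
      - (if (j, i) = (0, 1) then (N : ℚ) else 0) := by
    intro j i
    simp only [ha, Prod.mk.injEq]
    split_ifs with h h' <;> simp_all
  have hsum : ∑ j, lam j = 0 := by
    simp only [hlam, ha']
    rw [← Fintype.sum_prod_type' (f := fun j i =>
        (if (1 - φ j * α - φ i) ^ N = 1 then (1 : ℚ) else 0)
      - (if (j, i) = (0, 1) then (N : ℚ) else 0)), Finset.sum_sub_distrib,
      hbij.sum_comp (fun x : F => if x ^ N = 1 then (1 : ℚ) else 0)]
    have hroots : Finset.univ.filter (fun x : F => x ^ N = 1) = Polynomial.nthRootsFinset N 1 := by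
      ext x
      simp [Polynomial.mem_nthRootsFinset (Nat.pos_of_ne_zero hN)]
    simp [Finset.sum_ite_eq', hroots, hζ.card_nthRootsFinset]
  obtain ⟨⟨j₀, i₀⟩, hji⟩ := hbij.2 ζ
  simp only at hji
  have hj₀ : j₀ ≠ 0 := by
    rintro rfl
    have hζφ : ζ = φ (1 - i₀) := by rw [← hji]; simp
    refine hNp (hζ.dvd_of_pow_eq_one _ ?_)
    have hne : (1 - i₀ : ZMod p) ≠ 0 := fun h => hζ.ne_zero hN (by rw [hζφ, h, map_zero])
    rw [hζφ, ← map_pow, ZMod.pow_card_sub_one_eq_one hne, map_one]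
  refine rank_circulant_eq_pred lam hsum (fun j hj => ?_) hj₀ ?_
  · rw [hlam]
    exact Finset.sum_nonneg fun i _ => hnonneg j hj i
  · rw [hlam]
    refine Finset.sum_pos' (fun i _ => hnonneg j₀ hj₀ i) ⟨i₀, Finset.mem_univ _, ?_⟩
    rw [ha, if_neg (fun h => hj₀ h.1), hji, if_pos hζ.pow_eq_one]
    exact one_pos
end
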